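/- In the Hecke–Clifford algebra G_n(q) the following conjugation identities hold: v_n t_{n−1} v_n = t_{n−1} e_{n−1}; v_n e_{n−1} v_n = −e_{n−1}; v_n t_i v_n = t_i for all i ≤ n−2; and v_n e_j v_n = e_j for all j ≤ n−2. Consequently, conjugation by v_n restricts to an algebra automorphism γ_n of the subalgebra G_n[0] sending t_{n−1} ↦ t_{n−1} e_{n−1}, e_{n−1} ↦ −e_{n−1}, and fixing t_i (i ≤ n−2) and e_j (j ≤ n−2). -/

import Mathlib

noncomputable section

/-- Generator index type for the Hecke–Clifford algebra `G_n(q)`: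
`Sum.inl i` is the braid-type generator `t_{i+1}` (the paper's 1-indexed `t_1, …, t_{n-1}`),
`Sum.inr j` is the Clifford generator `v_{j+1}` (the paper's 1-indexed `v_1, …, v_n`). -/
abbrev HCgen (n : ℕ) : Type := Fin (n - 1) ⊕ Fin n

/-- The generator `t_i` in the free algebra (0-indexed). -/
def tF (n : ℕ) (i : Fin (n - 1)) : FreeAlgebra ℂ (HCgen n) :=
  FreeAlgebra.ι ℂ (Sum.inl i)

/-- The generator `v_j` in the free algebra (0-indexed). -/
def vF (n : ℕ) (j : Fin n) : FreeAlgebra ℂ (HCgen n) :=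
  FreeAlgebra.ι ℂ (Sum.inr j)

/-- The defining relations of the Hecke–Clifford algebra `G_n(q)`. -/
inductive HCrel (q : ℂ) (n : ℕ) :
    FreeAlgebra ℂ (HCgen n) → FreeAlgebra ℂ (HCgen n) → Prop
  | braid (i j : Fin (n - 1)) (h : (j : ℕ) = (i : ℕ) + 1) :
      HCrel q n (tF n i * tF n j * tF n i) (tF n j * tF n i * tF n j)
  | tcomm (i j : Fin (n - 1)) (h : (i : ℕ) + 2 ≤ (j : ℕ) ∨ (j : ℕ) + 2 ≤ (i : ℕ)) :
      HCrel q n (tF n i * tF n j) (tF n j * tF n i)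
  | quad (i : Fin (n - 1)) :
      HCrel q n (tF n i * tF n i) (1 + (q - q⁻¹) • tF n i)
  | vsq (j : Fin n) :
      HCrel q n (vF n j * vF n j) 1
  | vanti (j k : Fin n) (h : j ≠ k) :
      HCrel q n (vF n j * vF n k) (-(vF n k * vF n j))
  | tv₁ (i : Fin (n - 1)) (j j' : Fin n) (hj : (j : ℕ) = (i : ℕ))
      (hj' : (j' : ℕ) = (i : ℕ) + 1) :
      HCrel q n (tF n i * vF n j) (vF n j' * tF n i)
  | tv₂ (i : Fin (n - 1)) (j j' : Fin n) (hj : (j : ℕ) = (i : ℕ))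
      (hj' : (j' : ℕ) = (i : ℕ) + 1) :
      HCrel q n (tF n i * vF n j') (vF n j * tF n i - (q - q⁻¹) • (vF n j - vF n j'))
  | tvcomm (i : Fin (n - 1)) (l : Fin n) (h : (l : ℕ) ≠ (i : ℕ) ∧ (l : ℕ) ≠ (i : ℕ) + 1) :
      HCrel q n (tF n i * vF n l) (vF n l * tF n i)

/-- The Hecke–Clifford algebra `G_n(q)`. -/
abbrev HeckeClifford (q : ℂ) (n : ℕ) := RingQuot (HCrel q n)

/-- The generator `t_i` of `G_n(q)` (0-indexed: `i = 0, …, n-2`). -/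
def HCt (q : ℂ) (n : ℕ) (i : Fin (n - 1)) : HeckeClifford q n :=
  RingQuot.mkAlgHom ℂ (HCrel q n) (tF n i)

/-- The generator `v_j` of `G_n(q)` (0-indexed: `j = 0, …, n-1`). -/
def HCv (q : ℂ) (n : ℕ) (j : Fin n) : HeckeClifford q n :=
  RingQuot.mkAlgHom ℂ (HCrel q n) (vF n j)

/-- The element `e_i := v_i v_{i+1}` of `G_n(q)` (0-indexed: `i = 0, …, n-2`). -/
def HCe (q : ℂ) (n : ℕ) (i : Fin (n - 1)) : HeckeClifford q n :=
  HCv q n ⟨(i : ℕ), by have := i.2; omega⟩ * HCv q n ⟨(i : ℕ) + 1, by have := i.2; omega⟩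

/-- The even subalgebra `G_n[0]` of `G_n(q)`, generated by the `t_i` and the `e_j`. -/
def HCeven (q : ℂ) (n : ℕ) : Subalgebra ℂ (HeckeClifford q n) :=
  Algebra.adjoin ℂ (Set.range (HCt q n) ∪ Set.range (HCe q n))

end

theorem conj_mul_of_anticomm {A : Type*} [Ring A] {v a b : A} (hv : v * v = 1)
    (ha : v * a = -(a * v)) (hb : v * b = -(b * v)) : v * (a * b) * v = a * b := by
  rw [← mul_assoc, ha, neg_mul, mul_assoc a, hb, mul_neg, neg_neg, mul_assoc, mul_assoc b, hv,
    mul_one]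

section Relations

variable (q : ℂ) (n : ℕ)

theorem HCv_mul_self (j : Fin n) : HCv q n j * HCv q n j = 1 := by
  simpa [HCv] using RingQuot.mkAlgHom_rel ℂ (HCrel.vsq (q := q) j)

theorem HCv_anticomm {j k : Fin n} (h : j ≠ k) :
    HCv q n j * HCv q n k = -(HCv q n k * HCv q n j) := by
  simpa [HCv] using RingQuot.mkAlgHom_rel ℂ (HCrel.vanti (q := q) j k h)

theorem HCt_mul_HCv (i : Fin (n - 1)) (j j' : Fin n) (hj : (j : ℕ) = i)
    (hj' : (j' : ℕ) = i + 1) : HCt q n i * HCv q n j = HCv q n j' * HCt q n i := by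
  simpa [HCt, HCv] using RingQuot.mkAlgHom_rel ℂ (HCrel.tv₁ (q := q) i j j' hj hj')

theorem HCt_comm_HCv (i : Fin (n - 1)) (l : Fin n)
    (h : (l : ℕ) ≠ i ∧ (l : ℕ) ≠ i + 1) : HCt q n i * HCv q n l = HCv q n l * HCt q n i := by
  simpa [HCt, HCv] using RingQuot.mkAlgHom_rel ℂ (HCrel.tvcomm (q := q) i l h)

theorem HCe_eq (i : Fin (n - 1)) (j j' : Fin n) (hj : (j : ℕ) = i)
    (hj' : (j' : ℕ) = i + 1) : HCe q n i = HCv q n j * HCv q n j' :=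
  congrArg₂ (HCv q n · * HCv q n ·) (Fin.ext hj.symm) (Fin.ext hj'.symm)

theorem HCv_conj_HCt_of_eq (i : Fin (n - 1)) (l : Fin n) (h : (l : ℕ) = i + 1) :
    HCv q n l * HCt q n i * HCv q n l = HCt q n i * HCe q n i := by
  have hi : (i : ℕ) < n := by omega
  rw [← HCt_mul_HCv q n i ⟨i, hi⟩ l rfl h, HCe_eq q n i ⟨i, hi⟩ l rfl h, mul_assoc]

theorem HCv_conj_HCe_of_eq (i : Fin (n - 1)) (l : Fin n) (h : (l : ℕ) = i + 1) :
    HCv q n l * HCe q n i * HCv q n l = -HCe q n i := by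
  have hi : (i : ℕ) < n := by omega
  have hne : l ≠ ⟨i, hi⟩ := fun hl => by
    have := congrArg Fin.val hl
    dsimp only at this
    omega
  rw [HCe_eq q n i ⟨i, hi⟩ l rfl h, mul_assoc, mul_assoc, HCv_mul_self, mul_one,
    HCv_anticomm q n hne]

theorem HCv_conj_HCt_of_ne (i : Fin (n - 1)) (l : Fin n)
    (h : (l : ℕ) ≠ i ∧ (l : ℕ) ≠ i + 1) :
    HCv q n l * HCt q n i * HCv q n l = HCt q n i := by
  rw [← HCt_comm_HCv q n i l h, mul_assoc, HCv_mul_self, mul_one]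

theorem HCv_conj_HCe_of_ne (i : Fin (n - 1)) (l : Fin n)
    (h : (l : ℕ) ≠ i ∧ (l : ℕ) ≠ i + 1) :
    HCv q n l * HCe q n i * HCv q n l = HCe q n i := by
  have h₁ : l ≠ ⟨i, by omega⟩ := fun hl => h.1 (congrArg Fin.val hl)
  have h₂ : l ≠ ⟨i + 1, by omega⟩ := fun hl => h.2 (congrArg Fin.val hl)
  exact conj_mul_of_anticomm (HCv_mul_self q n l) (HCv_anticomm q n h₁) (HCv_anticomm q n h₂)

end Relations

/-- Conjugation by an element squaring to one, as an algebra automorphism. -/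
def AlgEquiv.conjOfMulSelfEqOne {R A : Type*} [CommSemiring R] [Semiring A] [Algebra R A]
    (v : A) (hv : v * v = 1) : A ≃ₐ[R] A :=
  have hinv : ∀ x, v * (v * x * v) * v = x := fun x => by
    rw [mul_assoc v x v, ← mul_assoc v v, hv, one_mul, mul_assoc, hv, mul_one]
  { toFun := fun x => v * x * v
    invFun := fun x => v * x * v
    left_inv := hinv
    right_inv := hinv
    map_mul' := fun x y => by
      have : v * x * v * (v * y * v) = v * x * (v * v) * (y * v) := by simp only [mul_assoc]
      rw [this, hv, mul_one, mul_assoc, mul_assoc, mul_assoc]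
    map_add' := fun x y => by rw [mul_add, add_mul]
    commutes' := fun r => by
      rw [← Algebra.commutes, mul_assoc, hv, mul_one] }

/-- Conjugation by an element squaring to one, restricted to a subalgebra it maps into itself. -/
theorem Subalgebra.exists_algEquiv_conj {R A : Type*} [CommSemiring R] [Semiring A] [Algebra R A]
    (v : A) (hv : v * v = 1) (S : Subalgebra R A) (hS : ∀ x ∈ S, v * x * v ∈ S) :
    ∃ γ : S ≃ₐ[R] S, ∀ x : S, (γ x : A) = v * x * v := by
  let c : A ≃ₐ[R] A := AlgEquiv.conjOfMulSelfEqOne v hv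
  have hmap : S.map (c : A →ₐ[R] A) = S := by
    apply le_antisymm
    · rintro _ ⟨x, hx, rfl⟩
      exact hS x hx
    · exact fun x hx => ⟨v * x * v, hS x hx, c.symm_apply_apply x⟩
  exact ⟨(c.subalgebraMap S).trans (Subalgebra.equivOfEq _ _ hmap), fun _ => rfl⟩

/-- Conjugation by the last Clifford generator preserves the even subalgebra. -/
theorem HCv_conj_mem_HCeven (q : ℂ) (n : ℕ) (l : Fin n) (hl : (l : ℕ) + 1 = n)
    (x : HeckeClifford q n) (hx : x ∈ HCeven q n) :
    HCv q n l * x * HCv q n l ∈ HCeven q n := by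
  have ht (i) : HCt q n i ∈ HCeven q n := Algebra.subset_adjoin (Or.inl ⟨i, rfl⟩)
  have he (i) : HCe q n i ∈ HCeven q n := Algebra.subset_adjoin (Or.inr ⟨i, rfl⟩)
  let c : HeckeClifford q n ≃ₐ[ℂ] HeckeClifford q n :=
    AlgEquiv.conjOfMulSelfEqOne _ (HCv_mul_self q n l)
  suffices HCeven q n ≤ (HCeven q n).comap (c : HeckeClifford q n →ₐ[ℂ] HeckeClifford q n) from
    this hx
  refine Algebra.adjoin_le ?_
  rintro _ (⟨i, rfl⟩ | ⟨i, rfl⟩)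
  · change HCv q n l * HCt q n i * HCv q n l ∈ HCeven q n
    by_cases h : (l : ℕ) = i + 1
    · rw [HCv_conj_HCt_of_eq q n i l h]
      exact mul_mem (ht i) (he i)
    · rw [HCv_conj_HCt_of_ne q n i l ⟨by omega, h⟩]
      exact ht i
  · change HCv q n l * HCe q n i * HCv q n l ∈ HCeven q n
    by_cases h : (l : ℕ) = i + 1
    · rw [HCv_conj_HCe_of_eq q n i l h]
      exact neg_mem (he i)
    · rw [HCv_conj_HCe_of_ne q n i l ⟨by omega, h⟩]
      exact he i

/-- conjugation identities by the last Clifford generator `v_n` (paper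
1-indexing; here `HCv q n ⟨n-1,_⟩`) in `G_n(q)`, and the induced automorphism `γ_n`
of the even subalgebra `G_n[0]`. -/
theorem heckeClifford_conjugation_vLast (q : ℂ) (hq : q ≠ 0) (n : ℕ) (hn : 2 ≤ n) :
    (HCv q n ⟨n - 1, by omega⟩ * HCt q n ⟨n - 2, by omega⟩ * HCv q n ⟨n - 1, by omega⟩ =
        HCt q n ⟨n - 2, by omega⟩ * HCe q n ⟨n - 2, by omega⟩) ∧
    (HCv q n ⟨n - 1, by omega⟩ * HCe q n ⟨n - 2, by omega⟩ * HCv q n ⟨n - 1, by omega⟩ =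
        -(HCe q n ⟨n - 2, by omega⟩)) ∧
    (∀ i : Fin (n - 1), (i : ℕ) < n - 2 →
        HCv q n ⟨n - 1, by omega⟩ * HCt q n i * HCv q n ⟨n - 1, by omega⟩ = HCt q n i) ∧
    (∀ j : Fin (n - 1), (j : ℕ) < n - 2 →
        HCv q n ⟨n - 1, by omega⟩ * HCe q n j * HCv q n ⟨n - 1, by omega⟩ = HCe q n j) ∧
    (∃ γ : HCeven q n ≃ₐ[ℂ] HCeven q n,
      (∀ x : HCeven q n, (γ x : HeckeClifford q n) =
          HCv q n ⟨n - 1, by omega⟩ * (x : HeckeClifford q n) * HCv q n ⟨n - 1, by omega⟩) ∧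
      ((γ ⟨HCt q n ⟨n - 2, by omega⟩, by
            exact Algebra.subset_adjoin (Or.inl ⟨_, rfl⟩)⟩ : HeckeClifford q n) =
          HCt q n ⟨n - 2, by omega⟩ * HCe q n ⟨n - 2, by omega⟩) ∧
      ((γ ⟨HCe q n ⟨n - 2, by omega⟩, by
            exact Algebra.subset_adjoin (Or.inr ⟨_, rfl⟩)⟩ : HeckeClifford q n) =
          -(HCe q n ⟨n - 2, by omega⟩)) ∧
      (∀ i : Fin (n - 1), (i : ℕ) < n - 2 →
        (γ ⟨HCt q n i, Algebra.subset_adjoin (Or.inl ⟨_, rfl⟩)⟩ : HeckeClifford q n) =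
          HCt q n i) ∧
      (∀ j : Fin (n - 1), (j : ℕ) < n - 2 →
        (γ ⟨HCe q n j, Algebra.subset_adjoin (Or.inr ⟨_, rfl⟩)⟩ : HeckeClifford q n) =
          HCe q n j)) := by
  have hlast : n - 1 = n - 2 + 1 := by omega
  have h₁ := HCv_conj_HCt_of_eq q n ⟨n - 2, by omega⟩ ⟨n - 1, by omega⟩ hlast
  have h₂ := HCv_conj_HCe_of_eq q n ⟨n - 2, by omega⟩ ⟨n - 1, by omega⟩ hlast
  have h₃ (i : Fin (n - 1)) (hi : (i : ℕ) < n - 2) :=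
    HCv_conj_HCt_of_ne q n i ⟨n - 1, by omega⟩ (by dsimp only; omega)
  have h₄ (i : Fin (n - 1)) (hi : (i : ℕ) < n - 2) :=
    HCv_conj_HCe_of_ne q n i ⟨n - 1, by omega⟩ (by dsimp only; omega)
  obtain ⟨γ, hγ⟩ := Subalgebra.exists_algEquiv_conj _
    (HCv_mul_self q n ⟨n - 1, by omega⟩) (HCeven q n)
    (HCv_conj_mem_HCeven q n _ (by dsimp only; omega))
  exact ⟨h₁, h₂, h₃, h₄, γ, hγ, (hγ _).trans h₁, (hγ _).trans h₂,
    fun i hi => (hγ _).trans (h₃ i hi), fun j hj => (hγ _).trans (h₄ j hj)⟩
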